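/- Let K ⊂ ℂ be a compact convex set with nonempty interior, and let f be continuous on K and analytic on the interior of K. Then there exist a constant C ≥ 1 and a sequence of polynomials (p_n)_{n≥1} with deg p_n ≤ n such that sup_{z∈K} |f(z) − p_n(z)| ≤ C · E_n(f, K) for all n, and for every compact set E contained in the interior of K there exists c > 0 (depending on E) such that e^{c n} · sup_{z∈E} |f(z) − p_n(z)| → 0 as n → ∞. -/

import Mathlib

open Filter

/-- Sup of `|f - P|` over a set `E`. -/
noncomputable def supErr (f : ℂ → ℂ) (E : Set ℂ) (P : Polynomial ℂ) : ℝ :=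
  ⨆ z : E, ‖f z - P.eval (z : ℂ)‖

/-- `E_n(f, K)`: best uniform polynomial approximation error of degree at most `n`. -/
noncomputable def bestE (f : ℂ → ℂ) (K : Set ℂ) (n : ℕ) : ℝ :=
  ⨅ P : {P : Polynomial ℂ // P.natDegree ≤ n}, supErr f K P.1

/-- The curve `θ ↦ e^{iθ} / G θ`. -/
noncomputable def gam (G : ℝ → ℝ) (θ : ℝ) : ℂ := Complex.exp (θ * Complex.I) / (G θ : ℂ)

/-- Derivative of the curve `gam`. -/
noncomputable def gam' (G G' : ℝ → ℝ) (θ : ℝ) : ℂ :=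
  Complex.exp (θ * Complex.I) * (Complex.I * G θ - G' θ) / (G θ : ℂ) ^ 2

lemma hasDerivAt_gam {G G' : ℝ → ℝ} (hG : ∀ θ, HasDerivAt G (G' θ) θ) (hpos : ∀ θ, 0 < G θ)
    (θ : ℝ) : HasDerivAt (gam G) (gam' G G' θ) θ := by
  have h1 : HasDerivAt (fun t : ℝ => Complex.exp (t * Complex.I))
      (Complex.exp (θ * Complex.I) * (1 * Complex.I)) θ :=
    (((hasDerivAt_id θ).ofReal_comp).mul_const Complex.I).cexp
  have h2 := h1.div (hG θ).ofReal_comp (by exact_mod_cast (hpos θ).ne')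
  refine h2.congr_deriv ?_
  unfold gam'
  ring

lemma continuous_gam {G G' : ℝ → ℝ} (hG : ∀ θ, HasDerivAt G (G' θ) θ) (hpos : ∀ θ, 0 < G θ) :
    Continuous (gam G) :=
  continuous_iff_continuousAt.2 fun θ => (hasDerivAt_gam hG hpos θ).continuousAt

lemma continuous_gam' {G G' : ℝ → ℝ} (hG : ∀ θ, HasDerivAt G (G' θ) θ) (hpos : ∀ θ, 0 < G θ)
    (hG' : Continuous G') : Continuous (gam' G G') := by
  have : Continuous G := continuous_iff_continuousAt.2 fun θ => (hG θ).continuousAt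
  unfold gam'
  refine Continuous.div (by fun_prop) (by fun_prop) fun θ => ?_
  have := (hpos θ).ne'
  exact pow_ne_zero _ (by exact_mod_cast this)

lemma gam_periodic {G : ℝ → ℝ} (hper : G (2 * Real.pi) = G 0) :
    gam G (2 * Real.pi) = gam G 0 := by
  unfold gam
  rw [hper]
  simp

lemma integral_closed {U : Set ℂ} (hU : Convex ℝ U) (hUo : IsOpen U) {F : ℂ → ℂ}
    (hF : DifferentiableOn ℂ F U) {γ γ' : ℝ → ℂ} (hγ : ∀ θ, HasDerivAt γ (γ' θ) θ)
    (hγ' : Continuous γ') (hmem : ∀ θ, γ θ ∈ U) (hper : γ (2 * Real.pi) = γ 0) :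
    ∫ θ in (0:ℝ)..(2 * Real.pi), F (γ θ) * γ' θ = 0 := by
  obtain ⟨Φ, hΦ⟩ := hU.exists_forall_hasDerivWithinAt hF
  have hγc : Continuous γ := continuous_iff_continuousAt.2 fun θ => (hγ θ).continuousAt
  have hc : Continuous fun θ => F (γ θ) * γ' θ :=
    (hF.continuousOn.comp_continuous hγc hmem).mul hγ'
  have := intervalIntegral.integral_eq_sub_of_hasDerivAt (a := 0) (b := 2 * Real.pi)
    (f := fun θ => Φ (γ θ)) (f' := fun θ => F (γ θ) * γ' θ) (fun θ _ => by
      have h1 := (hΦ (γ θ) (hmem θ)).hasDerivAt (hUo.mem_nhds (hmem θ))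
      exact HasDerivAt.comp θ h1 (hγ θ)) (hc.intervalIntegrable _ _)
  rw [this, hper, sub_self]

lemma winding {G G' : ℝ → ℝ} (hG : ∀ θ, HasDerivAt G (G' θ) θ) (hpos : ∀ θ, 0 < G θ)
    (hG' : Continuous G') (hper : G (2 * Real.pi) = G 0) (z : ℂ)
    (hz : ∀ θ, 1 - z / gam G θ ∈ Complex.slitPlane) :
    ∫ θ in (0:ℝ)..(2 * Real.pi), gam' G G' θ / (gam G θ - z) = 2 * Real.pi * Complex.I := by
  have hg0 : ∀ θ, gam G θ ≠ 0 := fun θ => by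
    unfold gam
    exact div_ne_zero (Complex.exp_ne_zero _) (by exact_mod_cast (hpos θ).ne')
  have hgz : ∀ θ, gam G θ - z ≠ 0 := fun θ h => by
    have h1 := hz θ
    rw [← sub_eq_zero.1 h, div_self (hg0 θ)] at h1
    simp at h1
  have hc : Continuous fun θ => gam' G G' θ / (gam G θ - z) :=
    (continuous_gam' hG hpos hG').div ((continuous_gam hG hpos).sub continuous_const) hgz
  have := intervalIntegral.integral_eq_sub_of_hasDerivAt (a := 0) (b := 2 * Real.pi)
    (f := fun θ => Complex.log (1 - z / gam G θ) + ((θ : ℂ) * Complex.I - (Real.log (G θ) : ℂ)))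
    (f' := fun θ => gam' G G' θ / (gam G θ - z)) (fun θ _ => by
      have h0 := ((hasDerivAt_gam hG hpos θ).fun_inv (hg0 θ)).const_mul z
      have h1 := (h0.const_sub 1).clog_real (by simpa [div_eq_mul_inv] using hz θ)
      have h2 := (((hasDerivAt_id θ).ofReal_comp).mul_const Complex.I)
      have h3 := ((hG θ).log (hpos θ).ne').ofReal_comp
      have h4 := h1.add (h2.sub h3)
      refine (h4.congr_deriv ?_)
      have hG0 : (G θ : ℂ) ≠ 0 := by exact_mod_cast (hpos θ).ne'
      have e1 : 1 - z * (gam G θ)⁻¹ = (gam G θ - z) / gam G θ := by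
        field_simp [hg0 θ]
      have e2 : Complex.ofReal 1 * Complex.I - ((G' θ / G θ : ℝ) : ℂ)
          = gam' G G' θ / gam G θ := by
        have := Complex.exp_ne_zero (θ * Complex.I)
        unfold gam gam'
        push_cast
        field_simp
      rw [e1, e2]
      have := hgz θ
      have := hg0 θ
      field_simp
      ring) (hc.intervalIntegrable _ _)
  rw [this]
  simp only [gam_periodic hper, hper]
  push_cast
  ring
lemma peak {R ε : ℝ} (hR : 0 < R) (hε : 0 ≤ ε) {v : ℂ} (hv : ‖v‖ ≤ R) (hre : v.re ≤ ε) :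
    ‖1 + (v + v ^ 2 / (2 * R)) / (9 / 2 * R)‖ ^ 2
      ≤ 1 + 4 * ε / (9 / 2 * R) - ‖v‖ ^ 2 / (4 * (9 / 2 * R) ^ 2) := by
  set x := v.re with hx
  set y := v.im with hy
  have hn : ‖v‖ ^ 2 = x ^ 2 + y ^ 2 := by
    rw [← Complex.normSq_eq_norm_sq, Complex.normSq_apply]; ring
  have hn' : x ^ 2 + y ^ 2 ≤ R ^ 2 := by rw [← hn]; gcongr
  set a : ℝ := (2 * R)⁻¹ with ha
  have ha0 : 0 < a := by positivity
  have haR : a * R = 1 / 2 := by rw [ha]; field_simp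
  set b : ℝ := (9 / 2 * R)⁻¹ with hb
  have hb0 : 0 < b := by positivity
  have e : (1 + (v + v ^ 2 / (2 * R)) / (9 / 2 * R) : ℂ) = 1 + (v + v ^ 2 * (a:ℝ)) * (b:ℝ) := by
    rw [ha, hb]; push_cast; simp only [div_eq_mul_inv]
  have hP : (x + a * (x ^ 2 - y ^ 2)) = (v + v ^ 2 * (a:ℝ)).re := by
    simp [pow_two, ← hx, ← hy]; ring
  have hQ : (y + 2 * a * x * y) = (v + v ^ 2 * (a:ℝ)).im := by
    simp [pow_two, ← hx, ← hy]; ring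
  set h := v + v ^ 2 * (a:ℝ) with hh
  have hnh : h.re ^ 2 + h.im ^ 2 = (x ^ 2 + y ^ 2) * ((1 + a * x) ^ 2 + (a * y) ^ 2) := by
    rw [← hP, ← hQ]; ring
  have hlhs : ‖1 + h * (b:ℝ)‖ ^ 2 = 1 + 2 * b * h.re + b ^ 2 * (h.re ^ 2 + h.im ^ 2) := by
    rw [← Complex.normSq_eq_norm_sq, Complex.normSq_apply]; simp; ring
  have hxR : |x| ≤ R := (Complex.abs_re_le_norm v).trans hv
  have hax : |a * x| ≤ 1 / 2 := by rw [abs_mul, abs_of_pos ha0, ← haR]; gcongr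
  have hax' := abs_le.1 hax
  have hax2 : a ^ 2 * (x ^ 2 + y ^ 2) ≤ 1 / 4 := by
    have : a ^ 2 * (x ^ 2 + y ^ 2) ≤ a ^ 2 * R ^ 2 := by gcongr
    have h2 : a ^ 2 * R ^ 2 = 1 / 4 := by rw [← mul_pow, haR]; norm_num
    linarith only [this, h2]
  -- upper bound of the norm of h
  have hup : h.re ^ 2 + h.im ^ 2 ≤ 9 / 4 * (x ^ 2 + y ^ 2) := by
    rw [hnh]
    have : (1 + a * x) ^ 2 + (a * y) ^ 2 ≤ 9 / 4 := by nlinarith only [hax2, hax'.1, hax'.2]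
    have h2 := mul_le_mul_of_nonneg_left this (by positivity : 0 ≤ x ^ 2 + y ^ 2)
    linarith only [h2]
  have hlow : 1 / 4 * (x ^ 2 + y ^ 2) ≤ h.re ^ 2 + h.im ^ 2 := by
    rw [hnh]
    have : 1 / 4 ≤ (1 + a * x) ^ 2 + (a * y) ^ 2 := by
      nlinarith only [sq_nonneg (a * y), hax'.1, hax'.2]
    have h2 := mul_le_mul_of_nonneg_left this (by positivity : 0 ≤ x ^ 2 + y ^ 2)
    linarith only [h2]
  have hbR : b * R = 2 / 9 := by rw [hb]; field_simp
  have hab : b * (9 / 4) = a := by rw [hb, ha]; field_simp; norm_num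
  have hx2 : x ^ 2 ≤ R * |x| := by
    rw [← sq_abs, pow_two]; exact mul_le_mul_of_nonneg_right hxR (abs_nonneg x)
  have h3 : a * x ^ 2 ≤ |x| / 2 := by
    have h4 := mul_le_mul_of_nonneg_left hx2 ha0.le
    rw [← mul_assoc, haR] at h4
    linarith only [h4]
  have hre1 : h.re ≤ - |x| / 2 - a * y ^ 2 + 2 * ε := by
    rw [← hP]
    have h5 : a * x ^ 2 ≤ |x| / 2 := h3
    have h6 : x ≤ -|x| + 2 * ε := by
      rcases abs_cases x with h | h <;> linarith
    linarith only [h5, h6]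
  have hb2 : b * (h.re ^ 2 + h.im ^ 2) ≤ |x| / 2 + a * y ^ 2 := by
    have h1 : b * (h.re ^ 2 + h.im ^ 2) ≤ b * (9 / 4 * (x ^ 2 + y ^ 2)) := by gcongr
    have h2 : b * (9 / 4 * (x ^ 2 + y ^ 2)) = a * x ^ 2 + a * y ^ 2 := by rw [← hab]; ring
    linarith
  rw [e, hlhs, hn]
  have r1 : 4 * ε / (9 / 2 * R) = 4 * ε * b := by rw [hb]; rfl
  have r2 : (x ^ 2 + y ^ 2) / (4 * (9 / 2 * R) ^ 2) = 1 / 4 * (x ^ 2 + y ^ 2) * b ^ 2 := by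
    rw [hb]; field_simp
  rw [r1, r2]
  have k1 : b ^ 2 * (1 / 4 * (x ^ 2 + y ^ 2)) ≤ b ^ 2 * (h.re ^ 2 + h.im ^ 2) := by gcongr
  have k2 : b * (b * (h.re ^ 2 + h.im ^ 2) + h.re) ≤ b * (2 * ε) := by gcongr; linarith
  linarith only [k1, k2]

lemma peak_low {R : ℝ} (hR : 0 < R) {v : ℂ} (hv : ‖v‖ ≤ R) :
    ‖v‖ / (9 * R) ≤ ‖(v + v ^ 2 / (2 * R)) / (9 / 2 * R)‖ := by
  have e : (v + v ^ 2 / (2 * R)) / (9 / 2 * R) = v * (1 + v / (2 * R)) / ((9 / 2 * R : ℝ) : ℂ) := by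
    push_cast; ring
  rw [e, norm_div, norm_mul, Complex.norm_real, Real.norm_of_nonneg (by positivity)]
  have h1 : ‖v / (2 * R : ℂ)‖ ≤ 1 / 2 := by
    have : ‖(2 * R : ℂ)‖ = 2 * R := by
      rw [norm_mul, Complex.norm_real, Real.norm_of_nonneg hR.le]; simp
    rw [norm_div, this, div_le_iff₀ (by positivity)]; linarith
  have h2 : 1 / 2 ≤ ‖1 + v / (2 * R : ℂ)‖ := by
    have := norm_sub_norm_le (1 : ℂ) (-(v / (2 * R : ℂ)))
    rw [norm_neg, sub_neg_eq_add, norm_one] at this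
    linarith
  rw [div_le_div_iff₀ (by positivity) (by positivity)]
  have := mul_le_mul_of_nonneg_left h2 (norm_nonneg v)
  nlinarith [norm_nonneg v]

/-- The de la Vallée Poussin type polynomial. -/
noncomputable def vp (m : ℕ) (w : ℂ) : ℂ := w ^ m * (∑ i ∈ Finset.range m, w ^ i) / m

/-- Quotient of `1 - vp` by `1 - w`. -/
noncomputable def vq (m : ℕ) : Polynomial ℂ :=
  Polynomial.C (m : ℂ)⁻¹ * ∑ j ∈ Finset.range m, ∑ i ∈ Finset.range (m + j), Polynomial.X ^ i

lemma vq_mul (m : ℕ) (hm : 1 ≤ m) (w : ℂ) : (vq m).eval w * (1 - w) = 1 - vp m w := by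
  have hm' : (m : ℂ) ≠ 0 := by exact_mod_cast (by omega : m ≠ 0)
  unfold vq vp
  simp only [Polynomial.eval_mul, Polynomial.eval_C, Polynomial.eval_finsetSum,
    Polynomial.eval_pow, Polynomial.eval_X]
  rw [mul_assoc, Finset.sum_mul]
  have : ∀ j ∈ Finset.range m, (∑ i ∈ Finset.range (m + j), w ^ i) * (1 - w)
      = 1 - w ^ m * w ^ j := fun j _ => by
    rw [geom_sum_mul_neg, pow_add]
  rw [Finset.sum_congr rfl this, Finset.sum_sub_distrib, ← Finset.mul_sum]
  simp
  field_simp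

lemma vq_deg (m : ℕ) (hm : 1 ≤ m) : (vq m).natDegree ≤ 2 * m - 2 := by
  unfold vq
  refine (Polynomial.natDegree_C_mul_le _ _).trans ?_
  refine Polynomial.natDegree_sum_le_of_forall_le _ _ fun j hj => ?_
  refine Polynomial.natDegree_sum_le_of_forall_le _ _ fun i hi => ?_
  rw [Polynomial.natDegree_X_pow]
  simp at hi hj
  omega

lemma vp_bound (m : ℕ) (hm : 1 ≤ m) {w : ℂ} {B s : ℝ} (hB : ‖w‖ ^ m ≤ B) (hs : 0 < s)
    (hw : s ≤ ‖1 - w‖) : ‖vp m w‖ ≤ B * (1 + B) / (m * s) := by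
  have hm' : (0 : ℝ) < m := by exact_mod_cast hm
  have hw1 : (1 - w) ≠ 0 := fun h => by rw [h, norm_zero] at hw; linarith
  have : vp m w = w ^ m * (1 - w ^ m) / (m * (1 - w)) := by
    unfold vp
    rw [← geom_sum_mul_neg w m]
    have : (m : ℂ) ≠ 0 := by exact_mod_cast hm'.ne'
    field_simp
  rw [this, norm_div, norm_mul, norm_mul, norm_pow, Complex.norm_natCast]
  have h2 : ‖1 - w ^ m‖ ≤ 1 + B := by
    refine (norm_sub_le _ _).trans ?_
    rw [norm_one, norm_pow]; linarith
  have : 0 ≤ B := le_trans (by positivity) hB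
  gcongr
/-- Quantitative geometry of a convex set around the origin. -/
structure Geo (K : Set ℂ) (A : ℝ) : Prop where
  one_le : 1 ≤ A
  low : ∀ θ : ℝ, A⁻¹ ≤ gauge K (Complex.exp (θ * Complex.I))
  up : ∀ θ : ℝ, gauge K (Complex.exp (θ * Complex.I)) ≤ A
  lip : ∀ x y, |gauge K x - gauge K y| ≤ A * ‖x - y‖
  bdd : ∀ z ∈ K, ‖z‖ ≤ A

lemma exp_lip (a b : ℝ) :
    ‖Complex.exp (a * Complex.I) - Complex.exp (b * Complex.I)‖ ≤ |a - b| := by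
  have h : Complex.exp (a * Complex.I) - Complex.exp (b * Complex.I)
      = Complex.exp (b * Complex.I) * (Complex.exp (Complex.I * ((a - b : ℝ) : ℂ)) - 1) := by
    rw [mul_sub, ← Complex.exp_add, mul_one]
    congr 2
    push_cast; ring
  rw [h, norm_mul, Complex.norm_exp_ofReal_mul_I, one_mul]
  exact Real.norm_exp_I_mul_ofReal_sub_one_le

lemma exists_geo {K : Set ℂ} (hKc : IsCompact K) (hK : Convex ℝ K) (h0 : K ∈ nhds 0) :
    ∃ A, Geo K A := by
  obtain ⟨L, hL⟩ := hK.lipschitz_gauge h0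
  obtain ⟨R, hR⟩ := hKc.isBounded.subset_closedBall 0
  set A : ℝ := max (max 1 (L:ℝ)) R with hA
  have hA1 : 1 ≤ A := (le_max_left 1 (L:ℝ)).trans (le_max_left _ _)
  have hAL : (L:ℝ) ≤ A := (le_max_right 1 (L:ℝ)).trans (le_max_left _ _)
  have hAR : R ≤ A := le_max_right _ _
  have lip : ∀ x y, |gauge K x - gauge K y| ≤ A * ‖x - y‖ := fun x y => by
    have := hL.dist_le_mul x y
    rw [Real.dist_eq, dist_eq_norm] at this
    exact this.trans (by gcongr)
  have bdd : ∀ z ∈ K, ‖z‖ ≤ A := fun z hz => by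
    have := hR hz
    rw [mem_closedBall_zero_iff] at this
    linarith
  refine ⟨A, hA1, fun θ => ?_, fun θ => ?_, lip, bdd⟩
  · have := le_gauge_of_subset_closedBall (x := Complex.exp (θ * Complex.I))
      (absorbent_nhds_zero h0) (by linarith : (0:ℝ) ≤ A)
      (fun z hz => by rw [mem_closedBall_zero_iff]; exact bdd z hz)
    rwa [Complex.norm_exp_ofReal_mul_I, one_div] at this
  · have := lip (Complex.exp (θ * Complex.I)) 0
    rw [gauge_zero, sub_zero, sub_zero, Complex.norm_exp_ofReal_mul_I, mul_one] at this
    exact (le_abs_self _).trans this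

lemma Geo.plip {K : Set ℂ} {A : ℝ} (h : Geo K A) (a b : ℝ) :
    |gauge K (Complex.exp (a * Complex.I)) - gauge K (Complex.exp (b * Complex.I))|
      ≤ A * |a - b| :=
  (h.lip _ _).trans (mul_le_mul_of_nonneg_left (exp_lip a b) (by linarith [h.one_le]))

/-- The radial smoothing of the gauge. -/
lemma exists_G {K : Set ℂ} {A : ℝ} (h : Geo K A) (m : ℕ) (hm : 1 ≤ m) :
    ∃ G G' : ℝ → ℝ, (∀ θ, HasDerivAt G (G' θ) θ) ∧ Continuous G' ∧
      G (2 * Real.pi) = G 0 ∧ (∀ θ, |G' θ| ≤ A) ∧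
      (∀ θ : ℝ, gauge K (Complex.exp (θ * Complex.I)) + A / m ≤ G θ) ∧
      (∀ θ : ℝ, G θ ≤ gauge K (Complex.exp (θ * Complex.I)) + 3 * A / m) := by
  set p : ℝ → ℝ := fun θ => gauge K (Complex.exp (θ * Complex.I)) with hp
  have hA := h.one_le
  have hm' : (0 : ℝ) < m := by exact_mod_cast hm
  have plip : ∀ a b, |p a - p b| ≤ A * |a - b| := h.plip
  have hpc : Continuous p := by
    have : LipschitzWith ⟨A, by linarith⟩ p := LipschitzWith.of_dist_le_mul fun a b => by
      rw [Real.dist_eq, Real.dist_eq]; exact plip a b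
    exact this.continuous
  have hper : ∀ θ, p (θ + 2 * Real.pi) = p θ := fun θ => by
    simp only [hp]
    congr 1
    push_cast
    rw [add_mul, Complex.exp_add, Complex.exp_two_pi_mul_I, mul_one]
  have hItg : ∀ a b, IntervalIntegrable p MeasureTheory.volume a b :=
    fun a b => hpc.intervalIntegrable a b
  have havg : ∀ θ, |m * (∫ t in θ..(θ + 1 / m), p t) - p θ| ≤ A / m := fun θ => by
    have e : m * (∫ t in θ..(θ + 1 / m), p t) - p θ
        = m * (∫ t in θ..(θ + 1 / m), (p t - p θ)) := by
      rw [intervalIntegral.integral_sub (hItg _ _) (by simp), intervalIntegral.integral_const]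
      simp only [add_sub_cancel_left, smul_eq_mul]
      field_simp
    have b := intervalIntegral.norm_integral_le_of_norm_le_const (a := θ) (b := θ + 1 / m)
      (f := fun t => p t - p θ) (C := A / m) (fun t ht => by
        rw [Set.uIoc_of_le (by simp)] at ht
        rw [Real.norm_eq_abs]
        refine (plip t θ).trans ?_
        rw [abs_of_pos (by linarith [ht.1]), div_eq_mul_one_div]
        have := ht.2
        gcongr
        linarith)
    rw [e, abs_mul, abs_of_pos hm', ← Real.norm_eq_abs]
    calc _ ≤ m * (A / m * |θ + 1 / m - θ|) := by gcongr
      _ = A / m := by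
        rw [add_sub_cancel_left, abs_of_pos (by positivity)]; field_simp
  refine ⟨fun θ => m * (∫ t in θ..(θ + 1 / m), p t) + 2 * A / m,
    fun θ => m * (p (θ + 1 / m) - p θ), fun θ => ?_, by fun_prop, ?_, fun θ => ?_,
    fun θ => ?_, fun θ => ?_⟩
  · have e : (fun θ : ℝ => ∫ t in θ..(θ + 1 / m), p t)
        = fun θ : ℝ => (∫ t in (0:ℝ)..(θ + 1 / m), p t) - ∫ t in (0:ℝ)..θ, p t := by
      funext θ
      rw [intervalIntegral.integral_interval_sub_left (hItg _ _) (hItg _ _)]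
    have d1 : ∀ x : ℝ, HasDerivAt (fun θ : ℝ => ∫ t in (0:ℝ)..θ, p t) (p x) x := fun x =>
      intervalIntegral.integral_hasDerivAt_right (hItg _ _)
        hpc.stronglyMeasurable.stronglyMeasurableAtFilter hpc.continuousAt
    have d2 : HasDerivAt (fun θ : ℝ => ∫ t in (0:ℝ)..(θ + 1 / m), p t) (p (θ + 1 / m)) θ := by
      have := (d1 (θ + 1 / m)).comp_add_const θ (1 / m)
      exact this
    have d3 := d2.sub (d1 θ)
    have d4 : HasDerivAt (fun θ : ℝ => ∫ t in θ..(θ + 1 / m), p t) (p (θ + 1 / m) - p θ) θ := by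
      rw [e]; exact d3
    exact (d4.const_mul (m:ℝ)).add_const _
  · have : (∫ t in (2 * Real.pi)..(2 * Real.pi + 1 / m), p t) = ∫ t in (0:ℝ)..(0 + 1 / m), p t := by
      have := intervalIntegral.integral_comp_add_right (a := 0) (b := 0 + 1 / m) p (2 * Real.pi)
      simp only [hper] at this
      rw [this]
      congr 1 <;> ring
    simp only [this]
  · rw [abs_mul, abs_of_pos hm']
    have := plip (θ + 1 / m) θ
    rw [add_sub_cancel_left, abs_of_pos (by positivity : (0:ℝ) < 1 / m)] at this
    calc _ ≤ m * (A * (1 / m)) := by gcongr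
      _ = A := by field_simp
  · have := (abs_le.1 (havg θ)).1
    have e : 2 * A / m = A / m + A / m := by ring
    simp only
    linarith
  · have := (abs_le.1 (havg θ)).2
    have e : 2 * A / m = A / m + A / m := by ring
    have e : 3 * A / m = A / m + A / m + A / m := by ring
    simp only
    linarith

lemma support_dir {K : Set ℂ} (hK : Convex ℝ K) (h0 : K ∈ nhds 0) (ζ : ℂ)
    (hζ : gauge K ζ = 1) : ∃ c : ℂ, ‖c‖ = 1 ∧ ∀ z ∈ K, (c * z).re ≤ (c * ζ).re := by
  have hnot : ζ ∉ interior K := fun h => by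
    rw [← gauge_lt_one_iff_mem_interior hK h0] at h; linarith
  obtain ⟨f, hf⟩ := RCLike.geometric_hahn_banach_open_point (𝕜 := ℂ) hK.interior
    isOpen_interior hnot
  have hf' : ∀ z, f z = f 1 * z := fun z => by
    have := f.map_smul z 1
    rw [smul_eq_mul, mul_one, smul_eq_mul] at this
    rw [this, mul_comm]
  have h0i : (0:ℂ) ∈ interior K := mem_interior_iff_mem_nhds.2 h0
  have hne : f 1 ≠ 0 := fun h => by
    have := hf 0 h0i
    rw [hf' 0, hf' ζ, h] at this
    simp at this
  have hcl : ∀ z ∈ K, (f 1 * z).re ≤ (f 1 * ζ).re := fun z hz => by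
    have hz' : z ∈ closure (interior K) := by
      rw [hK.closure_interior_eq_closure_of_nonempty_interior ⟨0, h0i⟩]
      exact subset_closure hz
    have hcl : IsClosed {z : ℂ | (f 1 * z).re ≤ (f 1 * ζ).re} :=
      isClosed_le (by fun_prop) (by fun_prop)
    refine closure_minimal (fun x hx => ?_) hcl hz'
    have := hf x hx
    rw [hf' x, hf' ζ] at this
    exact this.le
  refine ⟨f 1 / ((‖f 1‖ : ℝ) : ℂ), ?_, fun z hz => ?_⟩
  · rw [norm_div, Complex.norm_real, norm_norm, div_self (norm_ne_zero_iff.2 hne)]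
  · rw [div_mul_eq_mul_div, div_mul_eq_mul_div, Complex.div_ofReal_re, Complex.div_ofReal_re]
    have := hcl z hz
    gcongr

/-- All the data of the discretised curve at level `m`. -/
structure Crv (K : Set ℂ) (A : ℝ) (m : ℕ) (G G' : ℝ → ℝ) (c : ℝ → ℂ) : Prop where
  der : ∀ θ, HasDerivAt G (G' θ) θ
  cont' : Continuous G'
  per : G (2 * Real.pi) = G 0
  glow : ∀ θ, A⁻¹ ≤ G θ
  gup : ∀ θ, G θ ≤ 4 * A
  dbd : ∀ θ, ‖gam' G G' θ‖ ≤ 5 * A ^ 3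
  gaugeup : ∀ θ, gauge K (gam G θ) ≤ 1 - 1 / (4 * m)
  gaugelow : ∀ θ, 1 - 3 * A ^ 2 / m ≤ gauge K (gam G θ)
  cmeas : Measurable c
  cnorm : ∀ θ, ‖c θ‖ = 1
  csupp : ∀ θ, ∀ z ∈ K, (c θ * (z - gam G θ)).re ≤ 5 * A ^ 3 / m

lemma exists_crv {K : Set ℂ} (hK : Convex ℝ K) (h0 : K ∈ nhds 0) {A : ℝ} (h : Geo K A)
    (m : ℕ) (hm : 1 ≤ m) : ∃ G G' c, Crv K A m G G' c := by
  obtain ⟨G, G', h1, h2, h3, h4, h5, h6⟩ := exists_G h m hm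
  set p : ℝ → ℝ := fun θ => gauge K (Complex.exp (θ * Complex.I)) with hp
  have hA := h.one_le
  have hA0 : 0 < A := by linarith
  have hm' : (1 : ℝ) ≤ m := by exact_mod_cast hm
  have hm0 : (0 : ℝ) < m := by linarith
  have plow : ∀ θ, A⁻¹ ≤ p θ := h.low
  have pup : ∀ θ, p θ ≤ A := h.up
  have ppos : ∀ θ, 0 < p θ := fun θ => lt_of_lt_of_le (by positivity) (plow θ)
  have glow : ∀ θ, A⁻¹ ≤ G θ := fun θ => by
    have : 0 < A / m := by positivity
    linarith [h5 θ, plow θ]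
  have gpos : ∀ θ, 0 < G θ := fun θ => lt_of_lt_of_le (by positivity) (glow θ)
  have ginv : ∀ θ, (G θ)⁻¹ ≤ A := fun θ => by
    rw [inv_le_comm₀ (gpos θ) hA0]; exact glow θ
  have pinv : ∀ θ, (p θ)⁻¹ ≤ A := fun θ => by
    rw [inv_le_comm₀ (ppos θ) hA0]; exact plow θ
  have gup : ∀ θ, G θ ≤ 4 * A := fun θ => by
    have : 3 * A / m ≤ 3 * A := div_le_self (by positivity) hm'
    linarith [h6 θ, pup θ]
  have hgg : ∀ θ, gauge K (gam G θ) = p θ / G θ := fun θ => by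
    have e : gam G θ = (G θ)⁻¹ • Complex.exp (θ * Complex.I) := by
      unfold gam
      rw [Complex.real_smul, div_eq_inv_mul]; push_cast; rfl
    rw [e, gauge_smul_of_nonneg (by have := gpos θ; positivity), smul_eq_mul]
    simp only [hp]; ring
  have hsup : ∀ j : ℤ, ∃ c : ℂ, ‖c‖ = 1 ∧ ∀ z ∈ K,
      (c * z).re ≤ (c * gam p (j / m)).re := fun j => by
    refine support_dir hK h0 _ ?_
    have e : gam p (j / m) = (p (j / m))⁻¹ • Complex.exp (((j / m : ℝ) : ℂ) * Complex.I) := by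
      unfold gam
      rw [Complex.real_smul, div_eq_inv_mul]; push_cast; rfl
    have := ppos (j / m)
    rw [e, gauge_smul_of_nonneg (by positivity), smul_eq_mul]
    exact inv_mul_cancel₀ this.ne'
  choose U hU1 hU2 using hsup
  refine ⟨G, G', fun θ => U ⌊m * θ⌋, h1, h2, h3, glow, gup, fun θ => ?_, fun θ => ?_, fun θ => ?_,
    ?_, fun θ => hU1 _, fun θ z hz => ?_⟩
  · unfold gam'
    rw [norm_div, norm_mul, Complex.norm_exp_ofReal_mul_I, one_mul, norm_pow, Complex.norm_real,
      Real.norm_of_nonneg (gpos θ).le, div_eq_mul_inv, ← inv_pow]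
    have : ‖Complex.I * (G θ : ℂ) - (G' θ : ℂ)‖ ≤ 5 * A := by
      refine (norm_sub_le _ _).trans ?_
      rw [norm_mul, Complex.norm_I, one_mul, Complex.norm_real, Complex.norm_real,
        Real.norm_of_nonneg (gpos θ).le, Real.norm_eq_abs]
      linarith [gup θ, h4 θ]
    have i1 := ginv θ
    have i2 : 0 ≤ (G θ)⁻¹ := by have := gpos θ; positivity
    calc _ ≤ (5 * A) * A ^ 2 := by gcongr
      _ = 5 * A ^ 3 := by ring
  · rw [hgg, div_le_iff₀ (gpos θ)]
    have e1 : 1 / (4 * (m:ℝ)) * G θ ≤ 1 / (4 * m) * (4 * A) := by gcongr; exact gup θ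
    have e2 : 1 / (4 * (m:ℝ)) * (4 * A) = A / m := by field_simp
    linarith [h5 θ]
  · rw [hgg, le_div_iff₀ (gpos θ)]
    have e1 : 3 * A ^ 2 / m * A⁻¹ ≤ 3 * A ^ 2 / m * G θ := by gcongr; exact glow θ
    have e2 : 3 * A ^ 2 / m * A⁻¹ = 3 * A / m := by field_simp
    linarith [h6 θ]
  · exact (measurable_from_top (f := U)).comp (Int.measurable_floor.comp (measurable_const_mul _))
  · set j := ⌊m * θ⌋ with hj
    set t : ℝ := j / m with ht
    have ht1 : |θ - t| ≤ 1 / m := by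
      have a1 := Int.floor_le (m * θ)
      have a2 := Int.lt_floor_add_one (m * θ)
      have : θ - t = (m * θ - j) / m := by rw [ht]; field_simp
      rw [this, abs_of_nonneg (by apply div_nonneg <;> linarith)]
      gcongr
      linarith
    have key : ‖gam p t - gam G θ‖ ≤ 5 * A ^ 3 / m := by
      have e : gam p t - gam G θ = ((G θ - p t : ℝ) : ℂ) * ((p t)⁻¹ * (G θ)⁻¹ : ℝ)
          * Complex.exp (θ * Complex.I)
          + ((p t)⁻¹ : ℝ) * (Complex.exp (t * Complex.I) - Complex.exp (θ * Complex.I)) := by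
        unfold gam
        have q1 : (p t : ℂ) ≠ 0 := by exact_mod_cast (ppos t).ne'
        have q2 : (G θ : ℂ) ≠ 0 := by exact_mod_cast (gpos θ).ne'
        push_cast
        field_simp
        ring
      have b1 : |G θ - p t| ≤ 4 * A / m := by
        have c1 : |G θ - p θ| ≤ 3 * A / m := by
          have : 0 < A / m := by positivity
          rw [abs_of_nonneg (by linarith [h5 θ])]
          linarith [h6 θ]
        have c2 : |p θ - p t| ≤ A * (1 / m) := (h.plip θ t).trans (by gcongr)
        have := abs_sub_le (G θ) (p θ) (p t)
        have e : 4 * A / m = 3 * A / m + A * (1 / m) := by ring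
        linarith
      have q1 := pinv t
      have q2 := ginv θ
      have q3 := ppos t
      have q4 := gpos θ
      have b2 : ‖Complex.exp (t * Complex.I) - Complex.exp (θ * Complex.I)‖ ≤ 1 / m := by
        refine (exp_lip t θ).trans ?_
        rwa [abs_sub_comm]
      rw [e]
      refine (norm_add_le _ _).trans ?_
      rw [norm_mul, norm_mul, norm_mul, Complex.norm_exp_ofReal_mul_I, Complex.norm_real,
        Complex.norm_real, Complex.norm_real, Real.norm_eq_abs,
        Real.norm_of_nonneg (by positivity), Real.norm_of_nonneg (by positivity), mul_one]
      calc _ ≤ 4 * A / m * (A * A) + A * (1 / m) := by gcongr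
        _ ≤ 4 * A / m * (A * A) + A ^ 3 * (1 / m) := by
          gcongr
          exact le_self_pow₀ hA (by norm_num)
        _ = 5 * A ^ 3 / m := by ring
    have h7 := hU2 j z hz
    have : (U j * (z - gam G θ)).re = (U j * z).re - (U j * gam p t).re
        + (U j * (gam p t - gam G θ)).re := by
      rw [mul_sub, mul_sub, Complex.sub_re, Complex.sub_re]; ring
    rw [this]
    have h8 := Complex.re_le_norm (U j * (gam p t - gam G θ))
    rw [norm_mul, hU1, one_mul] at h8
    linarith
lemma poisson_int (m : ℕ) (hm : 1 ≤ m) (φ : ℝ) :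
    ∫ θ in (0:ℝ)..(2 * Real.pi), ((m:ℝ) * (1 / (m:ℝ) ^ 2 + Real.sin ((θ - φ) / 2) ^ 2))⁻¹
      ≤ Real.pi ^ 2 := by
  have hm0 : (0:ℝ) < m := by exact_mod_cast hm
  set f : ℝ → ℝ := fun θ => ((m:ℝ) * (1 / (m:ℝ) ^ 2 + Real.sin (θ / 2) ^ 2))⁻¹ with hf
  have hfc : Continuous f := by
    refine Continuous.inv₀ (by fun_prop) fun θ => ?_
    positivity
  have hper : Function.Periodic f (2 * Real.pi) := fun θ => by
    simp only [hf]
    rw [show (θ + 2 * Real.pi) / 2 = θ / 2 + Real.pi by ring, Real.sin_add_pi, neg_sq]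
  have e1 : ∫ θ in (0:ℝ)..(2 * Real.pi), f (θ - φ)
      = ∫ θ in (-Real.pi)..Real.pi, f θ := by
    rw [intervalIntegral.integral_comp_sub_right]
    have := hper.intervalIntegral_add_eq (0 - φ) (-Real.pi)
    rw [show (0 - φ) + 2 * Real.pi = 2 * Real.pi - φ by ring,
      show -Real.pi + 2 * Real.pi = Real.pi by ring] at this
    exact this
  change ∫ θ in (0:ℝ)..(2 * Real.pi), f (θ - φ) ≤ _
  rw [e1]
  have hpi := Real.pi_pos
  have hle : ∀ θ ∈ Set.Icc (-Real.pi) Real.pi,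
      f θ ≤ m * (1 + (m / Real.pi * θ) ^ 2)⁻¹ := fun θ hθ => by
    have habs : |θ / 2| ≤ Real.pi / 2 := by
      rw [abs_div, abs_of_pos (by norm_num : (0:ℝ) < 2)]
      have := abs_le.2 ⟨hθ.1, hθ.2⟩
      linarith
    have h1 := Real.mul_abs_le_abs_sin habs
    have h2 : (2 / Real.pi * |θ / 2|) ^ 2 ≤ Real.sin (θ / 2) ^ 2 := by
      rw [← sq_abs (Real.sin _)]
      gcongr
    rw [mul_pow, sq_abs] at h2
    have h3 : (m:ℝ) * (1 + (m / Real.pi * θ) ^ 2)⁻¹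
        = ((m:ℝ) * (1 / (m:ℝ) ^ 2 + (2 / Real.pi) ^ 2 * (θ / 2) ^ 2))⁻¹ := by
      have h4 : (m:ℝ) * (1 / (m:ℝ) ^ 2 + (2 / Real.pi) ^ 2 * (θ / 2) ^ 2)
          = (1 + (m / Real.pi * θ) ^ 2) / m := by
        field_simp
      rw [h4, inv_div]
      exact (div_eq_mul_inv _ _).symm
    rw [h3]
    simp only [hf]
    gcongr
  have hc2 : Continuous fun θ : ℝ => (m:ℝ) * (1 + (m / Real.pi * θ) ^ 2)⁻¹ := by
    refine Continuous.mul (by fun_prop) (Continuous.inv₀ (by fun_prop) fun θ => ?_)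
    positivity
  calc _ ≤ ∫ θ in (-Real.pi)..Real.pi, (m:ℝ) * (1 + (m / Real.pi * θ) ^ 2)⁻¹ :=
        intervalIntegral.integral_mono_on (by linarith) (hfc.intervalIntegrable _ _)
          (hc2.intervalIntegrable _ _) hle
    _ ≤ Real.pi ^ 2 := by
      rw [intervalIntegral.integral_const_mul]
      have := intervalIntegral.integral_comp_mul_left (a := -Real.pi) (b := Real.pi)
        (fun x : ℝ => (1 + x ^ 2)⁻¹) (by positivity : (m / Real.pi : ℝ) ≠ 0)
      rw [this, integral_inv_one_add_sq, smul_eq_mul]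
      have a1 := Real.arctan_lt_pi_div_two (m / Real.pi * Real.pi)
      have a2 := Real.neg_pi_div_two_lt_arctan (m / Real.pi * -Real.pi)
      have e : (m:ℝ) * ((m / Real.pi)⁻¹ * (Real.arctan (m / Real.pi * Real.pi)
          - Real.arctan (m / Real.pi * -Real.pi)))
          = Real.pi * (Real.arctan (m / Real.pi * Real.pi)
          - Real.arctan (m / Real.pi * -Real.pi)) := by field_simp
      rw [e, pow_two]
      gcongr
      linarith

/-- The inner variable of the peaking polynomial. -/
noncomputable def pw (R : ℝ) (c ζ z : ℂ) : ℂ :=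
  1 + (c * (z - ζ) + (c * (z - ζ)) ^ 2 / (2 * R)) / (9 / 2 * R)

/-- The polynomial kernel replacing the Cauchy kernel. -/
noncomputable def kq (m : ℕ) (R : ℝ) (c ζ : ℂ) : Polynomial ℂ :=
  (vq m).comp (1 + Polynomial.C (c / (9 / 2 * R)) * (Polynomial.X - Polynomial.C ζ)
    + Polynomial.C (c ^ 2 / (2 * R) / (9 / 2 * R)) * (Polynomial.X - Polynomial.C ζ) ^ 2)
  * (Polynomial.C (c / (9 / 2 * R)) * (1 + Polynomial.C (c / (2 * R)) *
    (Polynomial.X - Polynomial.C ζ)))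

lemma kq_eval (m : ℕ) (R : ℝ) (c ζ z : ℂ) : (kq m R c ζ).eval z
    = (vq m).eval (pw R c ζ z) * (c / (9 / 2 * R) * (1 + c / (2 * R) * (z - ζ))) := by
  unfold kq pw
  simp only [Polynomial.eval_mul, Polynomial.eval_comp, Polynomial.eval_add, Polynomial.eval_one,
    Polynomial.eval_C, Polynomial.eval_sub, Polynomial.eval_X, Polynomial.eval_pow]
  congr 2
  ring

lemma kq_mul (m : ℕ) (hm : 1 ≤ m) (R : ℝ) (c ζ z : ℂ) :
    (kq m R c ζ).eval z * (ζ - z) = 1 - vp m (pw R c ζ z) := by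
  rw [kq_eval, ← vq_mul m hm, mul_assoc]
  congr 1
  unfold pw
  ring

lemma kq_deg (m : ℕ) (hm : 1 ≤ m) (R : ℝ) (c ζ : ℂ) : (kq m R c ζ).natDegree ≤ 4 * m - 3 := by
  unfold kq
  refine Polynomial.natDegree_mul_le.trans ?_
  have h1 : (1 + Polynomial.C (c / (9 / 2 * R)) * (Polynomial.X - Polynomial.C ζ)
    + Polynomial.C (c ^ 2 / (2 * R) / (9 / 2 * R)) *
      (Polynomial.X - Polynomial.C ζ) ^ 2 : Polynomial ℂ).natDegree ≤ 2 := by compute_degree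
  have h2 : (Polynomial.C (c / (9 / 2 * R)) * (1 + Polynomial.C (c / (2 * R)) *
    (Polynomial.X - Polynomial.C ζ)) : Polynomial ℂ).natDegree ≤ 1 := by compute_degree
  have h3 := Polynomial.natDegree_comp_le (p := vq m) (q := 1 + Polynomial.C (c / (9 / 2 * R))
    * (Polynomial.X - Polynomial.C ζ) + Polynomial.C (c ^ 2 / (2 * R) / (9 / 2 * R)) *
      (Polynomial.X - Polynomial.C ζ) ^ 2)
  have h4 := Nat.mul_le_mul (vq_deg m hm) h1
  omega

lemma int_poly {N : ℕ} {φ : ℝ → ℂ} {Q : ℝ → Polynomial ℂ} (a b : ℝ)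
    (hQ : ∀ θ, (Q θ).natDegree ≤ N)
    (hItg : ∀ x, IntervalIntegrable (fun θ => φ θ * (Q θ).eval x) MeasureTheory.volume a b) :
    ∃ r : Polynomial ℂ, r.natDegree ≤ N ∧ ∀ z, r.eval z = ∫ θ in a..b, φ θ * (Q θ).eval z := by
  set s := Finset.range (N + 1) with hs
  set v : ℕ → ℂ := fun i => i with hv
  have hinj : Set.InjOn v s := fun i _ j _ h => by simpa [hv] using h
  refine ⟨Lagrange.interpolate s v fun i => ∫ θ in a..b, φ θ * (Q θ).eval (v i), ?_, fun z => ?_⟩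
  · have := Lagrange.degree_interpolate_lt (s := s) (v := v)
      (fun i => ∫ θ in a..b, φ θ * (Q θ).eval (v i)) hinj
    rw [hs, Finset.card_range] at this
    exact Nat.lt_succ_iff.1 (by
      by_cases h0 : Lagrange.interpolate (Finset.range (N + 1)) v
        (fun i => ∫ θ in a..b, φ θ * (Q θ).eval (v i)) = 0
      · rw [h0]; simp
      · exact (Polynomial.natDegree_lt_iff_degree_lt h0).2 this)
  · have e : ∀ θ, φ θ * (Q θ).eval z
        = ∑ i ∈ s, φ θ * (Q θ).eval (v i) * (Lagrange.basis s v i).eval z := fun θ => by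
      have hd : (Q θ).degree < s.card := by
        rw [hs, Finset.card_range]
        exact lt_of_le_of_lt (Polynomial.degree_le_natDegree) (by
          exact_mod_cast Nat.lt_succ_of_le (hQ θ))
      have := congrArg (Polynomial.eval z) (Lagrange.eq_interpolate hinj hd)
      rw [Lagrange.interpolate_apply, Polynomial.eval_finsetSum] at this
      rw [this, Finset.mul_sum]
      refine Finset.sum_congr rfl fun i _ => ?_
      rw [Polynomial.eval_mul, Polynomial.eval_C]; ring
    simp_rw [e]
    rw [intervalIntegral.integral_finsetSum fun i _ => (hItg (v i)).mul_const _,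
      Lagrange.interpolate_apply, Polynomial.eval_finsetSum]
    refine Finset.sum_congr rfl fun i _ => ?_
    rw [Polynomial.eval_mul, Polynomial.eval_C, intervalIntegral.integral_mul_const]

lemma Crv.pos {K : Set ℂ} {A : ℝ} {m : ℕ} {G G' : ℝ → ℝ} {c : ℝ → ℂ} (h : Crv K A m G G' c)
    (hA : 1 ≤ A) (θ : ℝ) : 0 < G θ := lt_of_lt_of_le (by positivity) (h.glow θ)

lemma Crv.int {K : Set ℂ} {A : ℝ} {m : ℕ} {G G' : ℝ → ℝ} {c : ℝ → ℂ} (h : Crv K A m G G' c)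
    (hA : 1 ≤ A) {φ : ℝ → ℂ} (hφ : Continuous φ) (x : ℂ) :
    IntervalIntegrable (fun θ => φ θ * (kq m (2 * A) (c θ) (gam G θ)).eval x)
      MeasureTheory.volume 0 (2 * Real.pi) := by
  have hg := continuous_gam h.der (h.pos hA)
  set H : ℂ × ℂ → ℂ := fun q => (kq m (2 * A) q.1 q.2).eval x with hH
  have hHc : Continuous H := by
    simp only [hH, kq_eval]
    unfold pw
    fun_prop
  have hmeas : Measurable fun θ => H (c θ, gam G θ) :=
    hHc.measurable.comp (h.cmeas.prodMk hg.measurable)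
  obtain ⟨B, hB⟩ := ((isCompact_sphere (0:ℂ) 1).prod
    ((isCompact_Icc (a := (0:ℝ)) (b := 2 * Real.pi)).image hg)).exists_bound_of_continuousOn
    hHc.continuousOn
  have hb : IntervalIntegrable (fun θ => H (c θ, gam G θ)) MeasureTheory.volume 0 (2 * Real.pi) := by
    rw [intervalIntegrable_iff_integrableOn_Icc_of_le (by positivity)]
    refine MeasureTheory.Measure.integrableOn_of_bounded (M := B) measure_Icc_lt_top.ne
      hmeas.aestronglyMeasurable ?_
    refine (MeasureTheory.ae_restrict_iff' measurableSet_Icc).2 (Eventually.of_forall fun θ hθ => ?_)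
    exact hB _ ⟨by simp [h.cnorm], ⟨θ, hθ, rfl⟩⟩
  exact hb.continuousOn_mul hφ.continuousOn
/-- Constant in the peaking estimate. -/
noncomputable def D1 (A : ℝ) : ℝ :=
  Real.exp (3 * A ^ 2 / 2) * (1 + Real.exp (3 * A ^ 2 / 2)) * (18 * A)

lemma Crv.norm_gam {K : Set ℂ} {A : ℝ} {m : ℕ} {G G' : ℝ → ℝ} {c : ℝ → ℂ}
    (h : Crv K A m G G' c) (hA : 1 ≤ A) (θ : ℝ) : ‖gam G θ‖ = (G θ)⁻¹ := by
  unfold gam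
  rw [norm_div, Complex.norm_exp_ofReal_mul_I, Complex.norm_real,
    Real.norm_of_nonneg (h.pos hA θ).le, one_div]

lemma Crv.pk {K : Set ℂ} {A : ℝ} (hgeo : Geo K A) {m : ℕ} (hm : 1 ≤ m) {G G' : ℝ → ℝ} {c : ℝ → ℂ}
    (h : Crv K A m G G' c) {z : ℂ} (hz : z ∈ K) (θ : ℝ) (hne : 0 < ‖gam G θ - z‖) :
    ‖vp m (pw (2 * A) (c θ) (gam G θ) z)‖
      ≤ D1 A * Real.exp (-(m * ‖gam G θ - z‖ ^ 2 / (648 * A ^ 2))) / (m * ‖gam G θ - z‖) := by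
  have hA := hgeo.one_le
  have hA0 : 0 < A := by linarith
  have hm0 : (0:ℝ) < m := by exact_mod_cast hm
  set v := c θ * (z - gam G θ) with hv
  set t := ‖gam G θ - z‖ with ht
  have hvt : ‖v‖ = t := by rw [hv, norm_mul, h.cnorm, one_mul, norm_sub_rev]
  have hginv : ‖gam G θ‖ ≤ A := by
    rw [h.norm_gam hA, inv_le_comm₀ (h.pos hA θ) hA0]; exact h.glow θ
  have hvR : ‖v‖ ≤ 2 * A := by
    rw [hvt, ht]
    refine (norm_sub_le _ _).trans ?_
    linarith [hgeo.bdd z hz]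
  have hp := peak (R := 2 * A) (ε := 5 * A ^ 3 / m) (by positivity) (by positivity) hvR
    (h.csupp θ z hz)
  have hl := peak_low (R := 2 * A) (by positivity) hvR
  set w := pw (2 * A) (c θ) (gam G θ) z with hw
  have hw' : w = 1 + (v + v ^ 2 / (2 * ((2 * A : ℝ) : ℂ))) / (9 / 2 * ((2 * A : ℝ) : ℂ)) := rfl
  rw [← hw', hvt] at hp
  have h1w : ‖(v + v ^ 2 / (2 * ((2 * A : ℝ) : ℂ))) / (9 / 2 * ((2 * A : ℝ) : ℂ))‖ = ‖1 - w‖ := by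
    rw [hw', norm_sub_rev, add_sub_cancel_left]
  rw [h1w, hvt] at hl
  set X := 3 * A ^ 2 / 2 - m * t ^ 2 / (648 * A ^ 2) with hX
  have hpow : ‖w‖ ^ m ≤ Real.exp X := by
    have s1 : ‖w‖ ^ 2 ≤ Real.exp (2 * X / m) := by
      refine hp.trans ?_
      refine le_trans ?_ (Real.add_one_le_exp _)
      have e1 : 4 * (5 * A ^ 3 / m) / (9 / 2 * (2 * A)) = (20 / 9) * A ^ 2 / m := by
        field_simp; norm_num
      have e2 : t ^ 2 / (4 * (9 / 2 * (2 * A)) ^ 2) = t ^ 2 / (324 * A ^ 2) := by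
        congr 1; ring
      have e3 : 2 * X / m = 3 * A ^ 2 / m - t ^ 2 / (324 * A ^ 2) := by
        rw [hX]; field_simp; ring
      rw [e1, e2, e3]
      have : (20 / 9) * A ^ 2 / m ≤ 3 * A ^ 2 / m := by gcongr; norm_num
      linarith
    have s2 : (‖w‖ ^ m) ^ 2 ≤ (Real.exp X) ^ 2 := by
      rw [← pow_mul, mul_comm, pow_mul]
      calc (‖w‖ ^ 2) ^ m ≤ (Real.exp (2 * X / m)) ^ m := by gcongr
        _ = (Real.exp X) ^ 2 := by
          rw [← Real.exp_nat_mul, ← Real.exp_nat_mul]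
          congr 1
          push_cast
          field_simp
    exact (pow_le_pow_iff_left₀ (by positivity) (by positivity) (by norm_num)).1 s2
  have hb := vp_bound m hm hpow (by positivity) hl
  refine hb.trans ?_
  set Y := Real.exp (-(m * t ^ 2 / (648 * A ^ 2))) with hY
  have hXY : Real.exp X = Real.exp (3 * A ^ 2 / 2) * Y := by
    rw [hY, ← Real.exp_add, hX]; congr 1
  have hY1 : Y ≤ 1 := by
    rw [hY, Real.exp_le_one_iff, neg_nonpos]; positivity
  have hY0 : 0 < Y := Real.exp_pos _
  rw [hXY]
  set E := Real.exp (3 * A ^ 2 / 2) with hE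
  have hE0 : 0 < E := Real.exp_pos _
  calc E * Y * (1 + E * Y) / (m * (t / (9 * (2 * A))))
      ≤ E * Y * (1 + E * 1) / (m * (t / (9 * (2 * A)))) := by gcongr
    _ = D1 A * Y / (m * t) := by
      unfold D1
      rw [← hE]
      field_simp
      ring

lemma ang (a b θ φ : ℝ) (ha : 0 ≤ a) (hb : 0 ≤ b) :
    4 * a * b * Real.sin ((θ - φ) / 2) ^ 2
      ≤ ‖(a : ℂ) * Complex.exp (θ * Complex.I) - b * Complex.exp (φ * Complex.I)‖ ^ 2 := by
  have h1 : Real.sin ((θ - φ) / 2) ^ 2 = (1 - Real.cos (θ - φ)) / 2 := by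
    rw [Real.sin_sq_eq_half_sub]; 
    rw [show 2 * ((θ - φ) / 2) = θ - φ by ring]; ring
  have h2 : ‖(a : ℂ) * Complex.exp (θ * Complex.I) - b * Complex.exp (φ * Complex.I)‖ ^ 2
      = a ^ 2 + b ^ 2 - 2 * a * b * Real.cos (θ - φ) := by
    rw [← Complex.normSq_eq_norm_sq, Complex.normSq_apply]
    simp only [Complex.sub_re, Complex.sub_im, Complex.re_ofReal_mul, Complex.im_ofReal_mul,
      Complex.exp_ofReal_mul_I_re, Complex.exp_ofReal_mul_I_im, Real.cos_sub]
    have c1 := Real.sin_sq_add_cos_sq θ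
    have c2 := Real.sin_sq_add_cos_sq φ
    linear_combination a ^ 2 * c1 + b ^ 2 * c2
  rw [h1, h2]
  nlinarith [sq_nonneg (a - b)]

/-- Lower bound for the distance of the curve to a point on or outside the boundary. -/
lemma Crv.dist_low {K : Set ℂ} {A : ℝ} (hgeo : Geo K A) {m : ℕ} (hm : 1 ≤ m) {G G' : ℝ → ℝ}
    {c : ℝ → ℂ} (h : Crv K A m G G' c) {z : ℂ} (hz : 1 ≤ gauge K z) (θ : ℝ) :
    (1 / (m:ℝ) ^ 2 + Real.sin ((θ - z.arg) / 2) ^ 2) / (32 * A ^ 2) ≤ ‖gam G θ - z‖ ^ 2 := by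
  have hA := hgeo.one_le
  have hA0 : 0 < A := by linarith
  have hm0 : (0:ℝ) < m := by exact_mod_cast hm
  have h1 : 1 / (4 * m) ≤ A * ‖gam G θ - z‖ := by
    have := hgeo.lip (gam G θ) z
    have h2 := h.gaugeup θ
    have h3 := neg_abs_le (gauge K (gam G θ) - gauge K z)
    linarith
  have h1' : 1 / (m:ℝ) ^ 2 / (16 * A ^ 2) ≤ ‖gam G θ - z‖ ^ 2 := by
    have : (1 / (4 * m) : ℝ) ^ 2 ≤ (A * ‖gam G θ - z‖) ^ 2 := by gcongr
    rw [mul_pow] at this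
    rw [div_le_iff₀ (by positivity)]
    have e : (1 / (4 * m) : ℝ) ^ 2 = 1 / (m:ℝ) ^ 2 / 16 := by field_simp; norm_num
    rw [e] at this
    linarith
  have hzn : A⁻¹ ≤ ‖z‖ := by
    have := hgeo.lip z 0
    rw [gauge_zero, sub_zero, sub_zero] at this
    rw [inv_le_iff_one_le_mul₀ hA0, mul_comm]
    linarith [le_abs_self (gauge K z)]
  have h2 : Real.sin ((θ - z.arg) / 2) ^ 2 / A ^ 2 ≤ ‖gam G θ - z‖ ^ 2 := by
    have hG := h.pos hA θ
    have := ang (G θ)⁻¹ ‖z‖ θ z.arg (by positivity) (norm_nonneg _)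
    rw [Complex.norm_mul_exp_arg_mul_I] at this
    have e : gam G θ = ((G θ)⁻¹ : ℝ) * Complex.exp (θ * Complex.I) := by
      unfold gam; push_cast; rw [div_eq_inv_mul]
    rw [← e] at this
    refine le_trans ?_ this
    have g1 : (4 * A)⁻¹ ≤ (G θ)⁻¹ := by
      have := h.gup θ
      gcongr
    calc Real.sin ((θ - z.arg) / 2) ^ 2 / A ^ 2
        = 4 * (4 * A)⁻¹ * A⁻¹ * Real.sin ((θ - z.arg) / 2) ^ 2 := by field_simp
      _ ≤ _ := by gcongr
  have e : (1 / (m:ℝ) ^ 2 + Real.sin ((θ - z.arg) / 2) ^ 2) / (32 * A ^ 2)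
      = (1 / (m:ℝ) ^ 2 / (16 * A ^ 2)) / 2 + (Real.sin ((θ - z.arg) / 2) ^ 2 / A ^ 2) / 32 := by
    field_simp; ring
  rw [e]
  have : 0 ≤ ‖gam G θ - z‖ ^ 2 := by positivity
  linarith

/-- Final uniform constant. -/
noncomputable def D2 (A : ℝ) : ℝ := 5 * A ^ 3 * (32 * A ^ 2 * (A + D1 A))

lemma D1_pos {A : ℝ} (hA : 1 ≤ A) : 0 < D1 A := by
  unfold D1
  have : 0 < A := by linarith
  positivity

lemma Crv.ne {K : Set ℂ} {A : ℝ} (hgeo : Geo K A) {m : ℕ} (hm : 1 ≤ m) {G G' : ℝ → ℝ}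
    {c : ℝ → ℂ} (h : Crv K A m G G' c) {z : ℂ} (hz : 1 ≤ gauge K z) (θ : ℝ) :
    0 < ‖gam G θ - z‖ := by
  have h1 := h.dist_low hgeo hm hz θ
  have hA := hgeo.one_le
  have hm0 : (0:ℝ) < m := by exact_mod_cast hm
  have hA0 : 0 < A := by linarith
  have : 0 < (1 / (m:ℝ) ^ 2 + Real.sin ((θ - z.arg) / 2) ^ 2) / (32 * A ^ 2) := by positivity
  by_contra hcon
  have h0 : ‖gam G θ - z‖ = 0 := le_antisymm (not_lt.1 hcon) (norm_nonneg _)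
  rw [h0] at h1
  norm_num at h1
  norm_num at this
  linarith

lemma mul_arg {m : ℕ} (z : ℂ) : (((1 + 1 / m : ℝ) : ℂ) * z).arg = z.arg :=
  Complex.arg_real_mul _ (by positivity)

lemma Crv.boundary_bound {K : Set ℂ} (hK : Convex ℝ K) (h0 : K ∈ nhds 0)
    {A : ℝ} (hgeo : Geo K A) {m : ℕ} (hm : 1 ≤ m) {G G' : ℝ → ℝ}
    {c : ℝ → ℂ} (h : Crv K A m G G' c) {g : ℂ → ℂ} (hg : DifferentiableOn ℂ g (interior K))
    (hg1 : ∀ z ∈ K, ‖g z‖ ≤ 1) {z : ℂ} (hzK : z ∈ K) (hz : gauge K z = 1) :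
    ‖∫ θ in (0:ℝ)..(2 * Real.pi), (g (gam G θ) * gam' G G' θ) *
      (kq m (2 * A) (c θ) (gam G θ)).eval z‖ ≤ D2 A * Real.pi ^ 2 := by
  have hA := hgeo.one_le
  have hA0 : 0 < A := by linarith
  have hm0 : (0:ℝ) < m := by exact_mod_cast hm
  have hpos := h.pos hA
  have hgc := continuous_gam h.der hpos
  have hgc' := continuous_gam' h.der hpos h.cont'
  have hmem : ∀ θ, gam G θ ∈ interior K := fun θ => by
    rw [← gauge_lt_one_iff_mem_interior hK h0]
    have : 0 < 1 / (4 * (m:ℝ)) := by positivity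
    linarith [h.gaugeup θ]
  have hφ : Continuous fun θ => g (gam G θ) * gam' G G' θ :=
    (hg.continuousOn.comp_continuous hgc hmem).mul hgc'
  set z' : ℂ := ((1 + 1 / m : ℝ) : ℂ) * z with hz'
  have hgz' : gauge K z' = 1 + 1 / m := by
    have : z' = (1 + 1 / m : ℝ) • z := by rw [Complex.real_smul]
    rw [this, gauge_smul_of_nonneg (by positivity), hz, smul_eq_mul, mul_one]
  have hgz1 : 1 ≤ gauge K z' := by rw [hgz']; simp
  have hz'int : ∀ ζ ∈ interior K, ζ - z' ≠ 0 := fun ζ hζ heq => by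
    rw [sub_eq_zero.1 heq, ← gauge_lt_one_iff_mem_interior hK h0] at hζ
    linarith
  have hzero := integral_closed hK.interior isOpen_interior
    (F := fun ζ => g ζ / (ζ - z')) (hg.div (by fun_prop) hz'int)
    (hasDerivAt_gam h.der hpos) hgc' hmem (gam_periodic h.per)
  have hi2 : IntervalIntegrable (fun θ => g (gam G θ) / (gam G θ - z') * gam' G G' θ)
      MeasureTheory.volume 0 (2 * Real.pi) := by
    refine Continuous.intervalIntegrable ?_ _ _
    exact ((hg.continuousOn.comp_continuous hgc hmem).div (hgc.sub continuous_const)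
      fun θ => hz'int _ (hmem θ)).mul hgc'
  rw [← sub_zero (∫ θ in (0:ℝ)..(2 * Real.pi), (g (gam G θ) * gam' G G' θ) *
      (kq m (2 * A) (c θ) (gam G θ)).eval z), ← hzero,
      ← intervalIntegral.integral_sub (h.int hA hφ z) hi2]
  set S : ℝ → ℝ := fun θ => ((m:ℝ) * (1 / (m:ℝ) ^ 2 + Real.sin ((θ - z.arg) / 2) ^ 2))⁻¹ with hS
  have hSc : Continuous S := by
    refine Continuous.inv₀ (by fun_prop) fun θ => ?_
    positivity
  have hbound : ∀ θ, ‖g (gam G θ) * gam' G G' θ * (kq m (2 * A) (c θ) (gam G θ)).eval z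
      - g (gam G θ) / (gam G θ - z') * gam' G G' θ‖ ≤ D2 A * S θ := fun θ => by
    have n1 := h.ne hgeo hm hz.ge θ
    have n2 := h.ne hgeo hm hgz1 θ
    have d1 := h.dist_low hgeo hm hz.ge θ
    have d2 := h.dist_low hgeo hm hgz1 θ
    rw [hz', mul_arg, ← hz'] at d2
    set V := vp m (pw (2 * A) (c θ) (gam G θ) z) with hV
    have hV1 : ‖V‖ ≤ D1 A / (m * ‖gam G θ - z‖) := by
      refine (h.pk hgeo hm hzK θ n1).trans ?_
      have : Real.exp (-(m * ‖gam G θ - z‖ ^ 2 / (648 * A ^ 2))) ≤ 1 := by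
        rw [Real.exp_le_one_iff, neg_nonpos]; positivity
      have hD := D1_pos hA
      gcongr
      exact mul_le_of_le_one_right hD.le this
    have z1 : gam G θ - z ≠ 0 := norm_pos_iff.1 n1
    have z2 : gam G θ - z' ≠ 0 := norm_pos_iff.1 n2
    have hk : (kq m (2 * A) (c θ) (gam G θ)).eval z = (1 - V) / (gam G θ - z) := by
      rw [eq_div_iff z1]; exact kq_mul m hm _ _ _ _
    have e : g (gam G θ) * gam' G G' θ * (kq m (2 * A) (c θ) (gam G θ)).eval z
      - g (gam G θ) / (gam G θ - z') * gam' G G' θ = g (gam G θ) * gam' G G' θ *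
        ((z - z') / ((gam G θ - z) * (gam G θ - z')) - V / (gam G θ - z)) := by
      rw [hk]; field_simp; ring
    set T := (1 / (m:ℝ) ^ 2 + Real.sin ((θ - z.arg) / 2) ^ 2) with hT
    have hT0 : 0 < T := by positivity
    have hzz : ‖z - z'‖ ≤ A / m := by
      have : z - z' = -(((1 / m : ℝ) : ℂ) * z) := by rw [hz']; push_cast; ring
      rw [this, norm_neg, norm_mul, Complex.norm_real, Real.norm_of_nonneg (by positivity)]
      have := hgeo.bdd z hzK
      calc 1 / (m:ℝ) * ‖z‖ ≤ 1 / m * A := by gcongr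
        _ = A / m := by ring
    have hprod : T / (32 * A ^ 2) ≤ ‖gam G θ - z‖ * ‖gam G θ - z'‖ := by
      have : (T / (32 * A ^ 2)) ^ 2 ≤ (‖gam G θ - z‖ * ‖gam G θ - z'‖) ^ 2 := by
        rw [mul_pow, pow_two (T / _)]
        gcongr
      exact (pow_le_pow_iff_left₀ (by positivity) (by positivity) (by norm_num)).1 this
    have k1 : ‖(z - z') / ((gam G θ - z) * (gam G θ - z'))‖ ≤ 32 * A ^ 2 * A * S θ := by
      rw [norm_div, norm_mul]
      calc _ ≤ (A / m) / (T / (32 * A ^ 2)) := by gcongr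
        _ = 32 * A ^ 2 * A * S θ := by
          simp only [hS]; rw [← hT]; field_simp
    have k2 : ‖V / (gam G θ - z)‖ ≤ 32 * A ^ 2 * D1 A * S θ := by
      rw [norm_div]
      have hD := D1_pos hA
      calc _ ≤ D1 A / (m * ‖gam G θ - z‖) / ‖gam G θ - z‖ := by gcongr
        _ = D1 A / m / ‖gam G θ - z‖ ^ 2 := by field_simp
        _ ≤ D1 A / m / (T / (32 * A ^ 2)) := by gcongr
        _ = 32 * A ^ 2 * D1 A * S θ := by
          simp only [hS]; rw [← hT]; field_simp
    rw [e, norm_mul, norm_mul]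
    have k3 := hg1 _ (interior_subset (hmem θ))
    have k4 := h.dbd θ
    have k5 := norm_sub_le ((z - z') / ((gam G θ - z) * (gam G θ - z'))) (V / (gam G θ - z))
    calc _ ≤ 1 * (5 * A ^ 3) * (32 * A ^ 2 * A * S θ + 32 * A ^ 2 * D1 A * S θ) := by
          gcongr
          linarith
      _ = D2 A * S θ := by unfold D2; ring
  have hpi := Real.pi_pos
  refine (intervalIntegral.norm_integral_le_of_norm_le (g := fun θ => D2 A * S θ)
    (by positivity) (Eventually.of_forall fun θ _ => hbound θ)
    ((hSc.const_mul _).intervalIntegrable _ _)).trans ?_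
  rw [intervalIntegral.integral_const_mul]
  have hD := D1_pos hA
  have : 0 ≤ D2 A := by unfold D2; positivity
  gcongr
  exact poisson_int m hm z.arg

lemma Crv.interior_bound {K : Set ℂ} (hK : Convex ℝ K) (hKcl : IsClosed K) (h0 : K ∈ nhds 0)
    {A : ℝ} (hgeo : Geo K A) {m : ℕ} (hm : 1 ≤ m) {G G' : ℝ → ℝ}
    {c : ℝ → ℂ} (h : Crv K A m G G' c) {g : ℂ → ℂ} (hg : DifferentiableOn ℂ g (interior K))
    (hg1 : ∀ z ∈ K, ‖g z‖ ≤ 1) {z : ℂ} {d : ℝ} (hd : 0 < d) (hz : gauge K z ≤ 1 - d)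
    (hmd : 3 * A ^ 2 / m ≤ d / 2) :
    ‖2 * Real.pi * Complex.I * g z - ∫ θ in (0:ℝ)..(2 * Real.pi), (g (gam G θ) * gam' G G' θ) *
      (kq m (2 * A) (c θ) (gam G θ)).eval z‖
      ≤ 5 * A ^ 3 * D1 A / (d / (2 * A)) ^ 2 * (2 * Real.pi) *
        Real.exp (-((d / (2 * A)) ^ 2 / (648 * A ^ 2) * m)) := by
  have hA := hgeo.one_le
  have hA0 : 0 < A := by linarith
  have hm1 : (1:ℝ) ≤ m := by exact_mod_cast hm
  have hm0 : (0:ℝ) < m := by linarith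
  have hpos := h.pos hA
  have hgc := continuous_gam h.der hpos
  have hgc' := continuous_gam' h.der hpos h.cont'
  have hmem : ∀ θ, gam G θ ∈ interior K := fun θ => by
    rw [← gauge_lt_one_iff_mem_interior hK h0]
    have : 0 < 1 / (4 * (m:ℝ)) := by positivity
    linarith [h.gaugeup θ]
  have hzi : z ∈ interior K := by
    rw [← gauge_lt_one_iff_mem_interior hK h0]; linarith
  have hzK : z ∈ K := interior_subset hzi
  have hφ : Continuous fun θ => g (gam G θ) * gam' G G' θ :=
    (hg.continuousOn.comp_continuous hgc hmem).mul hgc'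
  have hdist : ∀ θ, d / (2 * A) ≤ ‖gam G θ - z‖ := fun θ => by
    have a1 := hgeo.lip (gam G θ) z
    have a2 := h.gaugelow θ
    have a3 := le_abs_self (gauge K (gam G θ) - gauge K z)
    rw [div_le_iff₀ (by positivity)]
    linarith
  have hd0 : 0 < d / (2 * A) := by positivity
  have hnz : ∀ θ, gam G θ - z ≠ 0 := fun θ =>
    norm_pos_iff.1 (lt_of_lt_of_le hd0 (hdist θ))
  have hslit : ∀ θ, 1 - z / gam G θ ∈ Complex.slitPlane := fun θ => by
    by_contra hcon
    rw [Complex.mem_slitPlane_iff_not_le_zero, not_not] at hcon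
    set t : ℂ := z / gam G θ with ht
    have ht1 : 1 ≤ t.re := by
      have := (Complex.le_def.1 hcon).1
      simp at this; exact this
    have ht2 : t.im = 0 := by
      have := (Complex.le_def.1 hcon).2
      simp at this; exact this
    have hg0 : gam G θ ≠ 0 := by
      rw [← norm_pos_iff, h.norm_gam hA]
      have := hpos θ
      positivity
    have hzt : z = t.re • gam G θ := by
      have : (t.re : ℂ) = t := Complex.ext (by simp) (by simp [ht2])
      rw [Complex.real_smul, this, ht, div_mul_cancel₀ _ hg0]
    have hgz : gauge K z = t.re * gauge K (gam G θ) := by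
      rw [hzt, gauge_smul_of_nonneg (by linarith), smul_eq_mul]
    have := h.gaugelow θ
    have a := gauge_nonneg (s := K) (gam G θ)
    nlinarith
  have hw := winding h.der hpos h.cont' h.per z hslit
  have hzero := integral_closed hK.interior isOpen_interior
    (F := dslope g z) ((Complex.differentiableOn_dslope (isOpen_interior.mem_nhds hzi)).2 hg)
    (hasDerivAt_gam h.der hpos) hgc' hmem (gam_periodic h.per)
  have hC : Continuous fun θ => g (gam G θ) * gam' G G' θ / (gam G θ - z) :=
    hφ.div (hgc.sub continuous_const) hnz
  have hC2 : Continuous fun θ => gam' G G' θ / (gam G θ - z) :=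
    hgc'.div (hgc.sub continuous_const) hnz
  have hcauchy : ∫ θ in (0:ℝ)..(2 * Real.pi), g (gam G θ) * gam' G G' θ / (gam G θ - z)
      = 2 * Real.pi * Complex.I * g z := by
    have e : ∀ θ, dslope g z (gam G θ) * gam' G G' θ
        = g (gam G θ) * gam' G G' θ / (gam G θ - z) - g z * (gam' G G' θ / (gam G θ - z)) :=
      fun θ => by
        rw [dslope_of_ne _ (sub_ne_zero.1 (hnz θ)), slope_def_field]
        have := hnz θ
        field_simp
    simp_rw [e] at hzero
    rw [intervalIntegral.integral_sub (hC.intervalIntegrable _ _)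
      ((hC2.const_mul _).intervalIntegrable _ _),
      intervalIntegral.integral_const_mul, hw, sub_eq_zero] at hzero
    rw [hzero]; ring
  rw [← hcauchy, ← intervalIntegral.integral_sub (hC.intervalIntegrable _ _) (h.int hA hφ z)]
  have hpi := Real.pi_pos
  refine (intervalIntegral.norm_integral_le_of_norm_le_const
    (C := 5 * A ^ 3 * D1 A / (d / (2 * A)) ^ 2 *
        Real.exp (-((d / (2 * A)) ^ 2 / (648 * A ^ 2) * m))) fun θ _ => ?_).trans ?_
  · set V := vp m (pw (2 * A) (c θ) (gam G θ) z) with hV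
    have hk : (kq m (2 * A) (c θ) (gam G θ)).eval z = (1 - V) / (gam G θ - z) := by
      rw [eq_div_iff (hnz θ)]; exact kq_mul m hm _ _ _ _
    have e : g (gam G θ) * gam' G G' θ / (gam G θ - z) - g (gam G θ) * gam' G G' θ *
        (kq m (2 * A) (c θ) (gam G θ)).eval z
        = g (gam G θ) * gam' G G' θ * V / (gam G θ - z) := by
      rw [hk]; ring
    have n1 : 0 < ‖gam G θ - z‖ := norm_pos_iff.2 (hnz θ)
    have hV1 := h.pk hgeo hm hzK θ n1
    rw [← hV] at hV1
    have hD := D1_pos hA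
    have hdd := hdist θ
    have hV2 : ‖V‖ ≤ D1 A * Real.exp (-((d / (2 * A)) ^ 2 / (648 * A ^ 2) * m))
        / (1 * (d / (2 * A))) := by
      refine hV1.trans ?_
      have : Real.exp (-(m * ‖gam G θ - z‖ ^ 2 / (648 * A ^ 2)))
          ≤ Real.exp (-((d / (2 * A)) ^ 2 / (648 * A ^ 2) * m)) := by
        rw [Real.exp_le_exp, neg_le_neg_iff, div_mul_eq_mul_div, mul_comm]
        gcongr
      gcongr
    rw [e, norm_div, norm_mul, norm_mul]
    have k3 := hg1 _ (interior_subset (hmem θ))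
    have k4 := h.dbd θ
    calc _ ≤ 1 * (5 * A ^ 3) * (D1 A * Real.exp (-((d / (2 * A)) ^ 2 / (648 * A ^ 2) * m))
        / (1 * (d / (2 * A)))) / (d / (2 * A)) := by gcongr
      _ = _ := by field_simp
  · rw [sub_zero, abs_of_pos (by positivity)]
    apply le_of_eq; ring
lemma core0 {K : Set ℂ} (hKc : IsCompact K) (hK : Convex ℝ K) (h0 : K ∈ nhds 0) :
    ∃ (C : ℝ) (B cc : ℝ → ℝ), 0 ≤ C ∧ (∀ d > 0, 0 < cc d) ∧ ∀ m : ℕ, 1 ≤ m → ∀ g : ℂ → ℂ,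
      DifferentiableOn ℂ g (interior K) → (∀ z ∈ K, ‖g z‖ ≤ 1) →
      ∃ r : Polynomial ℂ, r.natDegree ≤ 4 * m - 3 ∧ (∀ z ∈ K, ‖r.eval z‖ ≤ C) ∧
        ∀ d > 0, ∀ z, gauge K z ≤ 1 - d → ‖g z - r.eval z‖ ≤ B d * Real.exp (-(cc d * m)) := by
  obtain ⟨A, hgeo⟩ := exists_geo hKc hK h0
  have hA := hgeo.one_le
  have hA0 : 0 < A := by linarith
  have hpi := Real.pi_pos
  set C : ℝ := (2 * Real.pi)⁻¹ * |D2 A * Real.pi ^ 2| with hC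
  have hC0 : 0 ≤ C := by positivity
  set cc : ℝ → ℝ := fun d => (d / (2 * A)) ^ 2 / (648 * A ^ 2) with hcc
  set B1 : ℝ → ℝ := fun d => 5 * A ^ 3 * D1 A / (d / (2 * A)) ^ 2 with hB1
  have hD1 := D1_pos hA
  refine ⟨C, fun d => B1 d + (1 + C) * Real.exp (cc d * (6 * A ^ 2 / d)), cc, hC0,
    fun d hd => by simp only [hcc]; positivity, fun m hm g hg hg1 => ?_⟩
  have hm0 : (0:ℝ) < m := by exact_mod_cast hm
  obtain ⟨G, G', c, h⟩ := exists_crv hK h0 hgeo m hm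
  have hpos := h.pos hA
  have hgc := continuous_gam h.der hpos
  have hgc' := continuous_gam' h.der hpos h.cont'
  have hmem : ∀ θ, gam G θ ∈ interior K := fun θ => by
    rw [← gauge_lt_one_iff_mem_interior hK h0]
    have : 0 < 1 / (4 * (m:ℝ)) := by positivity
    linarith [h.gaugeup θ]
  have hφ : Continuous fun θ => g (gam G θ) * gam' G G' θ :=
    (hg.continuousOn.comp_continuous hgc hmem).mul hgc'
  obtain ⟨r, hr, hre⟩ := int_poly (N := 4 * m - 3) 0 (2 * Real.pi)
    (fun θ => kq_deg m hm (2 * A) (c θ) (gam G θ)) (fun x => h.int hA hφ x)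
  have hn : ‖(2 * Real.pi * Complex.I : ℂ)⁻¹‖ = (2 * Real.pi)⁻¹ := by
    simp [abs_of_pos hpi]
  have h2 : (2 * Real.pi * Complex.I : ℂ) ≠ 0 := by
    simp [hpi.ne']
  have hbd : ∀ z ∈ K, ‖(Polynomial.C (2 * Real.pi * Complex.I : ℂ)⁻¹ * r).eval z‖ ≤ C := by
    have hne : (interior K).Nonempty := ⟨0, mem_interior_iff_mem_nhds.2 h0⟩
    have hcl : closure (interior K) = K := by
      rw [hK.closure_interior_eq_closure_of_nonempty_interior hne, hKc.isClosed.closure_eq]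
    intro z hz
    refine Complex.norm_le_of_forall_mem_frontier_norm_le
      (f := fun z => (Polynomial.C (2 * Real.pi * Complex.I : ℂ)⁻¹ * r).eval z)
      (U := interior K) (hKc.isBounded.subset interior_subset)
      (Polynomial.differentiable _).diffContOnCl (fun w hw => ?_) (by rw [hcl]; exact hz)
    have hw' := frontier_interior_subset hw
    have hw1 := (gauge_eq_one_iff_mem_frontier hK h0).2 hw'
    have hwK : w ∈ K := hKc.isClosed.frontier_subset hw'
    have := h.boundary_bound hK h0 hgeo hm hg hg1 hwK hw1
    simp only [Polynomial.eval_mul, Polynomial.eval_C, norm_mul, hn, hre]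
    exact mul_le_mul_of_nonneg_left (this.trans (le_abs_self _)) (by positivity)
  refine ⟨Polynomial.C (2 * Real.pi * Complex.I : ℂ)⁻¹ * r,
    (Polynomial.natDegree_C_mul_le _ _).trans hr, hbd, fun d hd z hz => ?_⟩
  have hzi : z ∈ interior K := by
    rw [← gauge_lt_one_iff_mem_interior hK h0]; linarith
  have hzK : z ∈ K := interior_subset hzi
  have hccd : 0 < cc d := by simp only [hcc]; positivity
  have hB1d : 0 < B1 d := by simp only [hB1]; positivity
  by_cases hmd : 3 * A ^ 2 / m ≤ d / 2
  · have key := h.interior_bound hK hKc.isClosed h0 hgeo hm hg hg1 hd hz hmd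
    have e : g z - (Polynomial.C (2 * Real.pi * Complex.I : ℂ)⁻¹ * r).eval z
        = (2 * Real.pi * Complex.I : ℂ)⁻¹ * (2 * Real.pi * Complex.I * g z - r.eval z) := by
      rw [Polynomial.eval_mul, Polynomial.eval_C, mul_sub, inv_mul_cancel_left₀ h2]
    rw [e, norm_mul, hn, hre]
    calc _ ≤ (2 * Real.pi)⁻¹ * (B1 d * (2 * Real.pi) * Real.exp (-(cc d * m))) :=
          mul_le_mul_of_nonneg_left key (by positivity)
      _ = B1 d * Real.exp (-(cc d * m)) := by field_simp
      _ ≤ _ := by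
        apply mul_le_mul_of_nonneg_right _ (Real.exp_pos _).le
        have : 0 ≤ (1 + C) * Real.exp (cc d * (6 * A ^ 2 / d)) := by positivity
        linarith
  · push Not at hmd
    have hmle : (m:ℝ) ≤ 6 * A ^ 2 / d := by
      rw [lt_div_iff₀ hm0] at hmd
      rw [le_div_iff₀ hd]; nlinarith
    calc _ ≤ 1 + C := (norm_sub_le _ _).trans (add_le_add (hg1 z hzK) (hbd z hzK))
      _ ≤ (1 + C) * (Real.exp (cc d * (6 * A ^ 2 / d)) * Real.exp (-(cc d * m))) := by
        rw [← Real.exp_add]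
        apply le_mul_of_one_le_right (by linarith)
        apply Real.one_le_exp
        nlinarith [mul_le_mul_of_nonneg_left hmle hccd.le]
      _ ≤ _ := by
        rw [add_mul, ← mul_assoc]
        have := mul_pos hB1d (Real.exp_pos (-(cc d * m)))
        linarith

lemma core1 {K : Set ℂ} (hKc : IsCompact K) (hK : Convex ℝ K) (hne : (interior K).Nonempty) :
    ∃ (C : ℝ) (N : ℝ → Set ℂ) (B cc : ℝ → ℝ), 0 ≤ C ∧ (∀ d > 0, 0 < cc d) ∧
      (∀ E, IsCompact E → E ⊆ interior K → ∃ d > 0, E ⊆ N d) ∧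
      ∀ m : ℕ, 1 ≤ m → ∀ g : ℂ → ℂ,
      DifferentiableOn ℂ g (interior K) → (∀ z ∈ K, ‖g z‖ ≤ 1) →
      ∃ r : Polynomial ℂ, r.natDegree ≤ 4 * m - 3 ∧ (∀ z ∈ K, ‖r.eval z‖ ≤ C) ∧
        ∀ d > 0, ∀ z ∈ N d, ‖g z - r.eval z‖ ≤ B d * Real.exp (-(cc d * m)) := by
  obtain ⟨a, ha⟩ := hne
  set τ : ℂ ≃ₜ ℂ := Homeomorph.addRight a with hτ
  have hτa : ∀ z, τ z = z + a := fun z => rfl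
  set K' : Set ℂ := τ ⁻¹' K with hK'
  have hItg : interior K' = τ ⁻¹' interior K := (τ.preimage_interior K).symm
  have hK'c : IsCompact K' := τ.isCompact_preimage.2 hKc
  have hK'conv : Convex ℝ K' := hK.translate_preimage_left a
  have h0 : K' ∈ nhds 0 := by
    rw [← mem_interior_iff_mem_nhds, hItg]
    simpa [hτa] using ha
  obtain ⟨C, B, cc, hC, hcc, H⟩ := core0 hK'c hK'conv h0
  refine ⟨C, fun d => {z | gauge K' (z - a) ≤ 1 - d}, B, cc, hC, hcc, fun E hE hEK => ?_,
    fun m hm g hg hg1 => ?_⟩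
  · rcases E.eq_empty_or_nonempty with rfl | hEne
    · exact ⟨1, one_pos, Set.empty_subset _⟩
    have hcont : Continuous fun z => gauge K' (z - a) :=
      (continuous_gauge hK'conv h0).comp (continuous_id.sub continuous_const)
    obtain ⟨x, hx, hmax⟩ := hE.exists_isMaxOn hEne hcont.continuousOn
    have hx1 : gauge K' (x - a) < 1 := by
      rw [gauge_lt_one_iff_mem_interior hK'conv h0, hItg]
      simpa [hτa] using hEK hx
    refine ⟨1 - gauge K' (x - a), by linarith, fun z hz => ?_⟩
    have := hmax hz
    simp only [Set.mem_ofPred_eq] at this ⊢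
    linarith
  · obtain ⟨r, hr, hrb, hre⟩ := H m hm (fun z => g (z + a))
      (hg.comp (differentiable_id.add_const a).differentiableOn
        (fun z hz => by rw [hItg] at hz; exact hz)) (fun z hz => hg1 _ hz)
    refine ⟨r.comp (Polynomial.X - Polynomial.C a), ?_, fun z hz => ?_, fun d hd z hz => ?_⟩
    · rw [Polynomial.natDegree_comp, Polynomial.natDegree_X_sub_C, mul_one]; exact hr
    · have : z - a ∈ K' := by simpa [hK', hτa] using hz
      simpa using hrb _ this
    · simpa using hre d hd (z - a) hz

lemma exact_poly {K : Set ℂ} (hK : K.Infinite) (f : ℂ → ℂ) (n : ℕ)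
    (h : ∀ ε > 0, ∃ P : Polynomial ℂ, P.natDegree ≤ n ∧ ∀ z ∈ K, ‖f z - P.eval z‖ ≤ ε) :
    ∃ P : Polynomial ℂ, P.natDegree ≤ n ∧ ∀ z ∈ K, f z = P.eval z := by
  obtain ⟨s, hsK, hs⟩ := hK.exists_subset_card_eq (n + 1)
  have hinj : Set.InjOn (id : ℂ → ℂ) s := Function.injective_id.injOn
  refine ⟨Lagrange.interpolate s id f, ?_, fun z hz => ?_⟩
  · have := Lagrange.degree_interpolate_lt (s := s) (v := id) f hinj
    rw [hs] at this
    exact Polynomial.natDegree_le_of_degree_le (Order.le_of_lt_succ this)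
  · set S : ℝ := ∑ i ∈ s, ‖(Lagrange.basis s id i).eval z‖ with hS
    have hS0 : 0 ≤ S := Finset.sum_nonneg fun _ _ => norm_nonneg _
    rw [← sub_eq_zero, ← norm_eq_zero]
    refine le_antisymm (le_of_forall_pos_le_add fun ε hε => ?_) (norm_nonneg _)
    obtain ⟨P, hP, hPf⟩ := h (ε / (1 + S)) (by positivity)
    have hPi : P = Lagrange.interpolate s id (fun i => P.eval (id i)) :=
      Lagrange.eq_interpolate hinj (by
        rw [hs]
        exact lt_of_le_of_lt (Polynomial.degree_le_of_natDegree_le hP) (by exact_mod_cast n.lt_succ_self))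
    have e : f z - (Lagrange.interpolate s id f).eval z
        = (f z - P.eval z) - ∑ i ∈ s, (f i - P.eval i) * (Lagrange.basis s id i).eval z := by
      conv_rhs => rw [show P.eval z = ∑ i ∈ s, P.eval i * (Lagrange.basis s id i).eval z by
        conv_lhs => rw [hPi]
        simp [Lagrange.interpolate_apply, Polynomial.eval_finsetSum]]
      simp only [Lagrange.interpolate_apply, Polynomial.eval_finsetSum, Polynomial.eval_mul,
        Polynomial.eval_C, sub_mul, Finset.sum_sub_distrib]
      ring
    rw [e]
    calc _ ≤ ε / (1 + S) + ∑ i ∈ s, ε / (1 + S) * ‖(Lagrange.basis s id i).eval z‖ := by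
          refine (norm_sub_le _ _).trans (add_le_add (hPf z hz) ((norm_sum_le _ _).trans ?_))
          refine Finset.sum_le_sum fun i hi => ?_
          rw [norm_mul]
          exact mul_le_mul_of_nonneg_right (hPf i (hsK hi)) (norm_nonneg _)
      _ = 0 + ε := by
          rw [← Finset.mul_sum, ← hS]; field_simp; ring

lemma supErr_nonneg (f : ℂ → ℂ) (K : Set ℂ) (P : Polynomial ℂ) : 0 ≤ supErr f K P :=
  Real.iSup_nonneg fun _ => norm_nonneg _

lemma bestE_nonneg (f : ℂ → ℂ) (K : Set ℂ) (n : ℕ) : 0 ≤ bestE f K n :=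
  Real.iInf_nonneg fun _ => supErr_nonneg _ _ _

lemma le_supErr {f : ℂ → ℂ} {K : Set ℂ} (hKc : IsCompact K) (hf : ContinuousOn f K)
    (P : Polynomial ℂ) {z : ℂ} (hz : z ∈ K) : ‖f z - P.eval z‖ ≤ supErr f K P := by
  have hb : BddAbove (Set.range fun z : K => ‖f z - P.eval (z : ℂ)‖) := by
    have := hKc.bddAbove_image (f := fun z => ‖f z - P.eval z‖)
      (hf.sub P.continuous.continuousOn).norm
    refine this.mono ?_
    rintro _ ⟨w, rfl⟩
    exact ⟨w, w.2, rfl⟩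
  exact le_ciSup hb ⟨z, hz⟩

lemma exists_near (f : ℂ → ℂ) (K : Set ℂ) (n : ℕ) {x : ℝ} (hx : bestE f K n < x) :
    ∃ P : Polynomial ℂ, P.natDegree ≤ n ∧ supErr f K P < x := by
  have : Nonempty {P : Polynomial ℂ // P.natDegree ≤ n} := ⟨⟨0, by simp⟩⟩
  obtain ⟨P, hP⟩ := exists_lt_of_ciInf_lt hx
  exact ⟨P.1, P.2, hP⟩

lemma bestE_le (f : ℂ → ℂ) (K : Set ℂ) (n : ℕ) : bestE f K n ≤ supErr f K 0 := by
  refine ciInf_le (f := fun P : {P : Polynomial ℂ // P.natDegree ≤ n} => supErr f K P.1)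
    ⟨0, ?_⟩ ⟨0, by simp⟩
  rintro _ ⟨P, rfl⟩
  exact supErr_nonneg _ _ _

theorem stmt_0 (K : Set ℂ) (hKc : IsCompact K) (hKconv : Convex ℝ K)
    (hKint : (interior K).Nonempty) (f : ℂ → ℂ)
    (hf_cont : ContinuousOn f K) (hf_an : DifferentiableOn ℂ f (interior K)) :
    ∃ (C : ℝ) (p : ℕ → Polynomial ℂ), 1 ≤ C ∧
      (∀ n : ℕ, 1 ≤ n → (p n).natDegree ≤ n) ∧
      (∀ n : ℕ, 1 ≤ n → ∀ z ∈ K,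
        ‖f z - (p n).eval z‖ ≤ C * bestE f K n) ∧
      (∀ E : Set ℂ, IsCompact E → E ⊆ interior K → ∃ c : ℝ, 0 < c ∧
        Tendsto (fun n : ℕ => Real.exp (c * n) * supErr f E (p n)) atTop (nhds 0)) := by
  obtain ⟨C, N, B, cc, hC, hcc, hN, H⟩ := core1 hKc hKconv hKint
  have hinf : K.Infinite := by
    obtain ⟨a, ha⟩ := hKint
    exact infinite_of_mem_nhds a (mem_interior_iff_mem_nhds.1 ha)
  have step : ∀ n : ℕ, ∃ p : Polynomial ℂ, 1 ≤ n → p.natDegree ≤ n ∧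
      (∀ z ∈ K, ‖f z - p.eval z‖ ≤ 2 * (1 + C) * bestE f K n) ∧
      ∀ d > 0, ∀ z ∈ N d, z ∈ K →
        ‖f z - p.eval z‖ ≤ 2 * bestE f K n * (|B d| * Real.exp (-(cc d / 4 * n))) := by
    intro n
    by_cases hn : 1 ≤ n
    swap
    · exact ⟨0, fun h => absurd h hn⟩
    rcases (bestE_nonneg f K n).eq_or_lt with h0 | hpos
    · obtain ⟨P, hP, hPf⟩ := exact_poly hinf f n (fun ε hε => by
        obtain ⟨P, hP, hPf⟩ := exists_near f K n (x := ε) (by rw [← h0]; exact hε)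
        exact ⟨P, hP, fun z hz => (le_supErr hKc hf_cont P hz).trans hPf.le⟩)
      refine ⟨P, fun _ => ⟨hP, fun z hz => ?_, fun d hd z hz hzK => ?_⟩⟩
      · rw [hPf z hz, ← h0]; simp
      · rw [hPf z hzK, ← h0]; simp
    · obtain ⟨q, hq, hqf⟩ := exists_near f K n (x := 2 * bestE f K n) (by linarith)
      set e : ℝ := 2 * bestE f K n with he
      have he0 : 0 < e := by positivity
      have hec : (e : ℂ) ≠ 0 := by exact_mod_cast he0.ne'
      have hne : ‖(e : ℂ)‖ = e := by rw [Complex.norm_real, Real.norm_of_nonneg he0.le]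
      have hqK : ∀ z ∈ K, ‖f z - q.eval z‖ ≤ e := fun z hz =>
        (le_supErr hKc hf_cont q hz).trans hqf.le
      obtain ⟨r, hr, hrb, hre⟩ := H ((n + 3) / 4) (by omega) (fun z => (f z - q.eval z) / e)
        ((hf_an.sub q.differentiable.differentiableOn).div_const _)
        (fun z hz => by rw [norm_div, hne]; exact (div_le_one he0).2 (hqK z hz))
      refine ⟨q + Polynomial.C (e : ℂ) * r, fun _ => ⟨?_, fun z hz => ?_, fun d hd z hz hzK => ?_⟩⟩
      · refine Polynomial.natDegree_add_le_of_degree_le hq ?_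
        exact (Polynomial.natDegree_C_mul_le _ _).trans (by omega)
      · have e1 : f z - (q + Polynomial.C (e : ℂ) * r).eval z = (f z - q.eval z) - e * r.eval z := by
          simp only [Polynomial.eval_add, Polynomial.eval_mul, Polynomial.eval_C]; ring
        rw [e1]
        calc _ ≤ e + e * C := by
              refine (norm_sub_le _ _).trans (add_le_add (hqK z hz) ?_)
              rw [norm_mul, hne]
              exact mul_le_mul_of_nonneg_left (hrb z hz) he0.le
          _ = _ := by rw [he]; ring
      · have e1 : f z - (q + Polynomial.C (e : ℂ) * r).eval z
            = e * ((f z - q.eval z) / e - r.eval z) := by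
          simp only [Polynomial.eval_add, Polynomial.eval_mul, Polynomial.eval_C]
          field_simp; ring
        rw [e1, norm_mul, hne]
        apply mul_le_mul_of_nonneg_left _ he0.le
        refine (hre d hd z hz).trans ?_
        refine mul_le_mul (le_abs_self _) (Real.exp_le_exp.2 ?_) (Real.exp_pos _).le (abs_nonneg _)
        have h4 : (n : ℝ) ≤ 4 * (((n + 3) / 4 : ℕ) : ℝ) := by
          have : n ≤ 4 * ((n + 3) / 4) := by omega
          exact_mod_cast this
        nlinarith [hcc d hd]
  choose p hp using step
  refine ⟨2 * (1 + C), p, by linarith, fun n hn => (hp n hn).1, fun n hn => (hp n hn).2.1,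
    fun E hE hEK => ?_⟩
  obtain ⟨d, hd, hEd⟩ := hN E hE hEK
  have hc := hcc d hd
  refine ⟨cc d / 8, by positivity, ?_⟩
  set M : ℝ := 2 * supErr f K 0 * |B d| with hM
  have hM0 : 0 ≤ M := by have := supErr_nonneg f K 0; positivity
  have hlim : Tendsto (fun n : ℕ => M * Real.exp (-(cc d / 8 * n))) atTop (nhds 0) := by
    have h1 : Tendsto (fun n : ℕ => cc d / 8 * (n : ℝ)) atTop atTop :=
      tendsto_natCast_atTop_atTop.const_mul_atTop (by positivity)
    have h2 := (Real.tendsto_exp_neg_atTop_nhds_zero.comp h1).const_mul M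
    simpa using h2
  refine squeeze_zero' (Eventually.of_forall fun n =>
    mul_nonneg (Real.exp_pos _).le (supErr_nonneg _ _ _)) ?_ hlim
  filter_upwards [eventually_ge_atTop 1] with n hn
  have hs : supErr f E (p n) ≤ M * Real.exp (-(cc d / 4 * n)) := by
    refine Real.iSup_le (fun z => ?_) (by positivity)
    refine ((hp n hn).2.2 d hd z (hEd z.2) (interior_subset (hEK z.2))).trans ?_
    rw [hM, mul_assoc (2 * supErr f K 0)]
    have := bestE_le f K n
    gcongr
  calc _ ≤ Real.exp (cc d / 8 * n) * (M * Real.exp (-(cc d / 4 * n))) :=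
        mul_le_mul_of_nonneg_left hs (Real.exp_pos _).le
    _ = M * Real.exp (-(cc d / 8 * n)) := by
        rw [mul_left_comm, ← Real.exp_add]; congr 2; ring
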